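/- Let X be a reflexive Banach space and Y an n-dimensional Banach space over K (ℝ or ℂ). Let f ∈ S_{X*} and Z = ker(f). Let A ∈ L(X,Y) and T_0 ∈ L_Z(X,Y), and set A_0 = A − T_0. Assume A_0 does not attain its norm on Z, i.e., M_{A_0} ∩ Z = ∅. Define F_{A_0} = {y* ∈ Ext(B_{Y*}) : there exists x ∈ M_{A_0} ∩ Ext(B_X) with f(x) > 0 (f(x) a positive real) and y*(A_0 x) = ‖A_0‖}. Then A_0 ⊥_B L_Z(X,Y) if and only if 0 belongs to the convex hull of F_{A_0}. -/

import Mathlib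

/-- `x` is an extreme point (with respect to real convex combinations) of the set `s`
in a vector space over `𝕜 = ℝ` or `ℂ`. -/
def RealExtremePoint (𝕜 : Type*) {E : Type*} [RCLike 𝕜] [AddCommGroup E] [Module 𝕜 E]
    (s : Set E) (x : E) : Prop :=
  x ∈ s ∧ ∀ y ∈ s, ∀ z ∈ s, ∀ t : ℝ, 0 < t → t < 1 →
    x = ((t : 𝕜)) • y + (((1 - t : ℝ) : 𝕜)) • z → y = x ∧ z = x

/-- Membership of `0` in the convex hull (with real coefficients) of a set `F`:
`0` is a convex combination of finitely many elements of `F`. -/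
def ZeroInRealConvexHull (𝕜 : Type*) {E : Type*} [RCLike 𝕜] [AddCommGroup E] [Module 𝕜 E]
    (F : Set E) : Prop :=
  ∃ (m : ℕ), 1 ≤ m ∧ ∃ (g : Fin m → E) (mu : Fin m → ℝ),
    (∀ i, g i ∈ F) ∧ (∀ i, 0 < mu i) ∧ (∑ i, mu i = 1) ∧
    (∑ i, ((mu i : 𝕜)) • g i = 0)


section Convexity

open Set Metric

variable {E : Type*} [NormedAddCommGroup E] [NormedSpace ℝ E] {s : Set E}

/-- The linear span of the minimal face of a convex set `s` containing `x`, translated to the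
origin. -/
def Convex.faceDirection (hs : Convex ℝ s) {x : E} (hx : x ∈ s) : Submodule ℝ E where
  carrier := {v | ∃ ε > 0, ∀ t : ℝ, |t| ≤ ε → x + t • v ∈ s}
  zero_mem' := ⟨1, one_pos, fun t _ => by simpa using hx⟩
  add_mem' := by
    rintro v w ⟨ε, hε, hv⟩ ⟨δ, hδ, hw⟩
    refine ⟨min ε δ / 2, by positivity, fun t ht => ?_⟩
    have h2 : |2 * t| ≤ min ε δ := by rw [abs_mul, abs_two]; linarith
    have := hs (hv _ (h2.trans (min_le_left _ _))) (hw _ (h2.trans (min_le_right _ _)))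
      (show (0 : ℝ) ≤ 1 / 2 by norm_num) (show (0 : ℝ) ≤ 1 / 2 by norm_num) (by norm_num)
    convert this using 1
    module
  smul_mem' := by
    rintro c v ⟨ε, hε, hv⟩
    refine ⟨ε / (|c| + 1), by positivity, fun t ht => ?_⟩
    rw [smul_smul]
    refine hv _ ?_
    rw [le_div_iff₀ (by positivity)] at ht
    rw [abs_mul]
    nlinarith [abs_nonneg t]

lemma Convex.mem_extremePoints_of_faceDirection_eq_bot (hs : Convex ℝ s) {x : E} (hx : x ∈ s)
    (h : hs.faceDirection hx = ⊥) : x ∈ s.extremePoints ℝ := by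
  refine mem_extremePoints_iff_left.2 ⟨hx, ?_⟩
  rintro y hy z hz ⟨a, b, ha, hb, hab, rfl⟩
  have hv : y - z ∈ hs.faceDirection hx := by
    refine ⟨min a b, lt_min ha hb, fun t ht => ?_⟩
    have h1 := abs_le.1 (ht.trans (min_le_left _ _))
    have h2 := abs_le.1 (ht.trans (min_le_right _ _))
    convert hs hy hz (show 0 ≤ a + t by linarith) (show 0 ≤ b - t by linarith) (by linarith)
      using 1
    module
  rw [h, Submodule.mem_bot, sub_eq_zero] at hv
  rw [hv, ← add_smul, hab, one_smul]

/-- Moving from `x` inside a compact convex set along a direction of its minimal face, one reaches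
a point whose minimal face is strictly smaller. -/
lemma Convex.exists_faceDirection_lt (hs : Convex ℝ s) (hc : IsCompact s) {x : E} (hx : x ∈ s)
    {v : E} (hv : v ∈ hs.faceDirection hx) (hv0 : v ≠ 0) :
    ∃ b > (0 : ℝ), ∃ hp : x + b • v ∈ s, hs.faceDirection hp < hs.faceDirection hx := by
  obtain ⟨ε, hε, hvε⟩ := hv
  have hI : IsCompact ((fun t : ℝ => x + t • v) ⁻¹' s) :=
    ((Homeomorph.addLeft x).isClosedEmbedding.comp
      (isClosedEmbedding_smul_left (𝕜 := ℝ) hv0)).isCompact_preimage hc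
  obtain ⟨b, hb, hmax⟩ := hI.exists_isMaxOn ⟨0, by simpa using hx⟩ continuousOn_id
  have hεb : ε ≤ b := hmax (hvε ε (abs_of_pos hε).le)
  have hb0 : 0 < b := hε.trans_le hεb
  refine ⟨b, hb0, hb, lt_of_le_of_ne ?_ ?_⟩
  · rintro w ⟨δ, hδ, hw⟩
    have hq := hvε (-ε) (by rw [abs_neg, abs_of_pos hε])
    refine ⟨ε / (b + ε) * δ, by positivity, fun t ht => ?_⟩
    have h1 : |(b + ε) / ε * t| ≤ δ := by
      rw [abs_mul, abs_of_pos (show 0 < (b + ε) / ε by positivity)]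
      calc (b + ε) / ε * |t| ≤ (b + ε) / ε * (ε / (b + ε) * δ) := by gcongr
        _ = δ := by field_simp
    convert hs (hw _ h1) hq (show 0 ≤ ε / (b + ε) by positivity)
      (show 0 ≤ b / (b + ε) by positivity) (by field_simp; ring) using 1
    match_scalars <;> field_simp
    all_goals ring
  · intro heq
    have hvx : v ∈ hs.faceDirection hx := ⟨ε, hε, hvε⟩
    rw [← heq] at hvx
    obtain ⟨δ, hδ, hw⟩ := hvx
    have h1 := hw δ (abs_of_pos hδ).le
    rw [add_assoc, ← add_smul] at h1
    have : b + δ ≤ b := hmax h1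
    linarith

/-- **Minkowski's theorem**: a compact convex set in a finite dimensional space is the convex hull
of its extreme points. -/
theorem IsCompact.convexHull_extremePoints [FiniteDimensional ℝ E] (hc : IsCompact s)
    (hs : Convex ℝ s) : convexHull ℝ (s.extremePoints ℝ) = s := by
  refine (convexHull_min extremePoints_subset hs).antisymm ?_
  suffices ∀ n : ℕ, ∀ x (hx : x ∈ s), Module.finrank ℝ (hs.faceDirection hx) = n →
      x ∈ convexHull ℝ (s.extremePoints ℝ) from fun x hx => this _ x hx rfl
  intro n
  induction n using Nat.strong_induction_on with
  | _ n ih =>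
    intro x hx hn
    by_cases hbot : hs.faceDirection hx = ⊥
    · exact subset_convexHull _ _ (hs.mem_extremePoints_of_faceDirection_eq_bot hx hbot)
    obtain ⟨v, hv, hv0⟩ := Submodule.exists_mem_ne_zero_of_ne_bot hbot
    obtain ⟨b, hb, hp, hpl⟩ := hs.exists_faceDirection_lt hc hx hv hv0
    obtain ⟨a, ha, hq, hql⟩ := hs.exists_faceDirection_lt hc hx (neg_mem hv) (neg_ne_zero.2 hv0)
    have hp' := ih _ (hn ▸ Submodule.finrank_lt_finrank_of_lt hpl) _ hp rfl
    have hq' := ih _ (hn ▸ Submodule.finrank_lt_finrank_of_lt hql) _ hq rfl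
    convert convex_convexHull ℝ _ hp' hq' (show 0 ≤ a / (a + b) by positivity)
      (show 0 ≤ b / (a + b) by positivity) (by field_simp) using 1
    match_scalars <;> field_simp
    all_goals ring

/-- In a finite dimensional space, the convex hull of a compact set is compact. -/
theorem IsCompact.convexHull_of_finiteDimensional [FiniteDimensional ℝ E] (hc : IsCompact s) :
    IsCompact (convexHull ℝ s) := by
  let N := Module.finrank ℝ E + 1
  have hK : IsCompact ((fun p : (Fin N → ℝ) × (Fin N → E) => ∑ i, p.1 i • p.2 i) ''
      (stdSimplex ℝ (Fin N) ×ˢ Set.univ.pi fun _ => s)) :=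
    ((isCompact_stdSimplex ℝ _).prod (isCompact_univ_pi fun _ => hc)).image (by fun_prop)
  convert hK
  refine subset_antisymm (fun x hx => ?_) ?_
  · obtain ⟨ι, _, z, w, hz, haff, hw, hw1, rfl⟩ := eq_pos_convex_span_of_mem_convexHull hx
    obtain ⟨x₀, hx₀⟩ := convexHull_nonempty_iff.1 ⟨_, hx⟩
    have hcard : Fintype.card ι ≤ Fintype.card (Fin N) := by
      rw [Fintype.card_fin]
      exact haff.card_le_finrank_succ.trans (Nat.succ_le_succ (Submodule.finrank_le _))
    obtain ⟨e⟩ := Function.Embedding.nonempty_of_card_le hcard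
    have hext : ∀ i, i ∉ Set.range e → Function.extend e w 0 i = 0 := fun i hi =>
      Function.extend_apply' _ _ _ hi
    refine ⟨(Function.extend e w 0, Function.extend e z fun _ => x₀), ⟨⟨fun i => ?_, ?_⟩, ?_⟩, ?_⟩
    · by_cases hi : i ∈ Set.range e
      · obtain ⟨j, rfl⟩ := hi
        exact (hw j).le.trans_eq (e.injective.extend_apply _ _ _).symm
      · exact (hext i hi).ge
    · rw [← hw1]
      exact (Fintype.sum_of_injective e e.injective _ _ hext
        fun i => (e.injective.extend_apply _ _ _).symm).symm
    · intro i _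
      by_cases hi : i ∈ Set.range e
      · obtain ⟨j, rfl⟩ := hi
        simpa only [e.injective.extend_apply] using hz ⟨j, rfl⟩
      · simpa only [Function.extend_apply' _ _ _ hi] using hx₀
    · refine (Fintype.sum_of_injective e e.injective _ _ (fun i hi => ?_) fun i => ?_).symm
      · simp only [hext i hi, zero_smul]
      · simp only [e.injective.extend_apply]
  · rintro _ ⟨⟨w, z⟩, ⟨⟨hw, hw1⟩, hz⟩, rfl⟩
    exact (convex_convexHull ℝ s).sum_mem (fun i _ => hw i) hw1
      fun i _ => subset_convexHull _ _ (hz i trivial)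

variable {V W F : Type*} [AddCommGroup V] [Module ℝ V] [TopologicalSpace V] [T2Space V]
  [IsTopologicalAddGroup V] [ContinuousSMul ℝ V] [LocallyConvexSpace ℝ V]
  [AddCommGroup W] [Module ℝ W] [TopologicalSpace W] [T2Space W]
  [IsTopologicalAddGroup W] [ContinuousSMul ℝ W] [LocallyConvexSpace ℝ W]
  [NormedAddCommGroup F] [NormedSpace ℝ F] [FiniteDimensional ℝ F]

/-- A continuous linear image in a finite dimensional space of the face of a compact convex set
where the linear functional `l` attains its upper bound `c` lies in the convex hull of the image of
those extreme points where `l` equals `c`. -/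
theorem IsCompact.map_mem_convexHull_extremePoints {C : Set V} (hc : IsCompact C)
    (hC : Convex ℝ C) (l : V →L[ℝ] ℝ) {c : ℝ} (hl : ∀ v ∈ C, l v ≤ c) (g : V →L[ℝ] F) {v : V}
    (hv : v ∈ C) (hvc : l v = c) :
    g v ∈ convexHull ℝ {k | ∃ u ∈ C.extremePoints ℝ, l u = c ∧ g u = k} := by
  let D := {u ∈ C | l u = c}
  have hDC : IsExtreme ℝ C D := by
    refine ⟨fun u hu => hu.1, ?_⟩
    rintro y hy z hz _ ⟨_, hu⟩ ⟨a, b, ha, hb, hab, rfl⟩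
    refine ⟨hy, (hl y hy).antisymm (le_of_not_gt fun h => hu.not_lt ?_)⟩
    rw [map_add, map_smul, map_smul, smul_eq_mul, smul_eq_mul]
    calc a * l y + b * l z < a * c + b * c :=
          add_lt_add_of_lt_of_le (by gcongr) (mul_le_mul_of_nonneg_left (hl z hz) hb.le)
      _ = c := by rw [← add_mul, hab, one_mul]
  have hDc : IsCompact D := hc.inter_right (isClosed_eq l.continuous continuous_const)
  have hDconv : Convex ℝ D := hC.inter (convex_hyperplane l.toLinearMap.isLinear c)
  have hgD : g v ∈ g '' D := ⟨v, ⟨hv, hvc⟩, rfl⟩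
  rw [← (hDc.image g.continuous).convexHull_extremePoints
    (hDconv.linear_image g.toLinearMap)] at hgD
  refine convexHull_mono (fun k hk => ?_) hgD
  obtain ⟨u, hu, rfl⟩ := surjOn_extremePoints_image g.toContinuousAffineMap hDc hk
  exact ⟨u, hDC.extremePoints_subset_extremePoints hu, hu.1.2, rfl⟩

/-- A bilinear version of `IsCompact.map_mem_convexHull_extremePoints`. -/
theorem IsCompact.map₂_mem_convexHull_extremePoints {P : Set V} {R : Set W} (hP : IsCompact P)
    (hPc : Convex ℝ P) (hR : IsCompact R) (hRc : Convex ℝ R)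
    (b : V →ₗ[ℝ] W →ₗ[ℝ] ℝ) (hb₁ : ∀ w, Continuous fun v => b v w) (hb₂ : ∀ v, Continuous (b v))
    (h : V →ₗ[ℝ] W →ₗ[ℝ] F) (hh₁ : ∀ w, Continuous fun v => h v w) (hh₂ : ∀ v, Continuous (h v))
    {c : ℝ} (hbc : ∀ v ∈ P, ∀ w ∈ R, b v w ≤ c) {v : V} (hv : v ∈ P) {w : W} (hw : w ∈ R)
    (hvw : b v w = c) :
    h v w ∈ convexHull ℝ
      {k | ∃ v ∈ P.extremePoints ℝ, ∃ w ∈ R.extremePoints ℝ, b v w = c ∧ h v w = k} := by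
  refine convexHull_min ?_ (convex_convexHull ℝ _) (hR.map_mem_convexHull_extremePoints hRc
    ⟨b v, hb₂ v⟩ (hbc v hv) ⟨h v, hh₂ v⟩ hw hvw)
  rintro _ ⟨u, hu, huc, rfl⟩
  refine convexHull_mono ?_ (hP.map_mem_convexHull_extremePoints hPc
    ⟨b.flip u, hb₁ u⟩ (fun v hv => hbc v hv u hu.1) ⟨h.flip u, hh₁ u⟩ hv huc)
  rintro _ ⟨v', hv', hvc, rfl⟩
  exact ⟨v', hv', u, hu, hvc, rfl⟩

theorem LinearMap.continuous_uncurry_of_finiteDimensional {V W F : Type*}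
    [AddCommGroup V] [Module ℝ V] [TopologicalSpace V]
    [AddCommGroup W] [Module ℝ W] [TopologicalSpace W] [T2Space W] [IsTopologicalAddGroup W]
    [ContinuousSMul ℝ W] [FiniteDimensional ℝ W] [AddCommGroup F] [Module ℝ F]
    [TopologicalSpace F] [IsTopologicalAddGroup F] [ContinuousSMul ℝ F]
    (b : V →ₗ[ℝ] W →ₗ[ℝ] F) (hb : ∀ w, Continuous fun v => b v w) :
    Continuous fun p : V × W => b p.1 p.2 := by
  let e := Module.finBasis ℝ W
  have : (fun p : V × W => b p.1 p.2) = fun p => ∑ i, e.coord i p.2 • b p.1 (e i) := by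
    ext p
    conv_lhs => rw [← e.sum_repr p.2]
    simp only [map_sum, map_smul, Module.Basis.coord_apply]
  rw [this]
  exact continuous_finsetSum _ fun i _ =>
    ((e.coord i).continuous_of_finiteDimensional.comp continuous_snd).smul
      ((hb (e i)).comp continuous_fst)

end Convexity

section RealExtremePoint

variable {𝕜 E E' : Type*} [RCLike 𝕜] [AddCommGroup E] [Module 𝕜 E] [AddCommGroup E'] [Module 𝕜 E']

lemma RealExtremePoint.of_mem_extremePoints [Module ℝ E] [IsScalarTower ℝ 𝕜 E] {s : Set E} {x : E}
    (h : x ∈ s.extremePoints ℝ) : RealExtremePoint 𝕜 s x := by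
  refine ⟨h.1, fun y hy z hz t ht ht1 hx => ?_⟩
  have hcast (r : ℝ) (v : E) : (r : 𝕜) • v = r • v := by
    rw [RCLike.ofReal_alg, smul_assoc, one_smul]
  rw [hcast, hcast] at hx
  exact (mem_extremePoints.1 h).2 y hy z hz ⟨t, 1 - t, ht, sub_pos.2 ht1, by ring, hx.symm⟩

lemma RealExtremePoint.of_map {s : Set E} {s' : Set E'} (g : E →ₗ[𝕜] E')
    (hg : Function.Injective g) (hs : Set.MapsTo g s s') {x : E} (hx : x ∈ s)
    (h : RealExtremePoint 𝕜 s' (g x)) : RealExtremePoint 𝕜 s x := by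
  refine ⟨hx, fun y hy z hz t ht ht1 hxt => ?_⟩
  have := h.2 (g y) (hs hy) (g z) (hs hz) t ht ht1 (by rw [hxt, map_add, map_smul, map_smul])
  exact ⟨hg this.1, hg this.2⟩

end RealExtremePoint

section RealExtremePointBall

open Metric

variable {𝕜 E : Type*} [RCLike 𝕜] [NormedAddCommGroup E] [NormedSpace 𝕜 E]

lemma RealExtremePoint.smul_of_norm_eq_one {x : E} (h : RealExtremePoint 𝕜 (closedBall (0 : E) 1) x)
    {u : 𝕜} (hu : ‖u‖ = 1) : RealExtremePoint 𝕜 (closedBall (0 : E) 1) (u • x) := by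
  have hu0 : u ≠ 0 := norm_ne_zero_iff.1 (hu ▸ one_ne_zero)
  refine RealExtremePoint.of_map (s' := closedBall (0 : E) 1) (LinearMap.lsmul 𝕜 E u⁻¹)
    (smul_right_injective E (inv_ne_zero hu0)) (fun y hy => ?_) ?_ ?_
  · simpa [norm_smul, hu] using hy
  · simpa [norm_smul, hu] using h.1
  · simpa [smul_smul, hu0] using h

lemma RealExtremePoint.norm_eq_one [Nontrivial E] {x : E}
    (h : RealExtremePoint 𝕜 (closedBall (0 : E) 1) x) : ‖x‖ = 1 := by
  have hx : ‖x‖ ≤ 1 := mem_closedBall_zero_iff.1 h.1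
  refine hx.antisymm (le_of_not_gt fun hlt => ?_)
  obtain ⟨y, hy⟩ := exists_ne (0 : E)
  let v : E := (((1 - ‖x‖) / ‖y‖ : ℝ) : 𝕜) • y
  have hv : ‖v‖ = 1 - ‖x‖ := by
    rw [norm_smul, RCLike.norm_ofReal, abs_of_nonneg (div_nonneg (sub_nonneg.2 hx) (norm_nonneg y)),
      div_mul_cancel₀ _ (norm_ne_zero_iff.2 hy)]
  have hadd : x + v ∈ closedBall (0 : E) 1 := by
    rw [mem_closedBall_zero_iff]; linarith [norm_add_le x v]
  have hsub : x - v ∈ closedBall (0 : E) 1 := by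
    rw [mem_closedBall_zero_iff]; linarith [norm_sub_le x v]
  have := (h.2 _ hadd _ hsub (1 / 2) (by norm_num) (by norm_num) (by
    push_cast; module)).1
  rw [add_eq_left] at this
  rw [this, norm_zero] at hv
  linarith

end RealExtremePointBall

lemma WeakDual.locallyConvexSpace_real {𝕜 E : Type*} [RCLike 𝕜] [NormedAddCommGroup E]
    [NormedSpace 𝕜 E] : LocallyConvexSpace ℝ (WeakDual 𝕜 E) :=
  have : IsScalarTower ℝ 𝕜 (WeakDual 𝕜 E) := inferInstanceAs (IsScalarTower ℝ 𝕜 (E →L[𝕜] 𝕜))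
  (topDualPairing 𝕜 E).weakBilin_withSeminorms.toLocallyConvexSpace

section Pairings

open Set Metric RCLike

variable {𝕜 X Y : Type*} [RCLike 𝕜] [NormedAddCommGroup X] [NormedSpace 𝕜 X]
  [NormedAddCommGroup Y] [NormedSpace 𝕜 Y]

/-- The real bilinear form `(Φ, ψ) ↦ re (Φ (ψ ∘ A))` on `X** × Y*`. -/
noncomputable def bidualPairing (A : X →L[𝕜] Y) :
    WeakDual 𝕜 (StrongDual 𝕜 X) →ₗ[ℝ] StrongDual 𝕜 Y →ₗ[ℝ] ℝ :=
  LinearMap.mk₂ ℝ (fun Φ ψ => re (Φ (ψ.comp A)))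
    (fun Φ Ψ ψ => by
      rw [← map_add]; rfl)
    (fun c Φ ψ => RCLike.smul_re c (Φ (ψ.comp A)))
    (fun Φ ψ χ => by
      rw [ContinuousLinearMap.add_comp, map_add, map_add])
    (fun c Φ ψ => by
      rw [ContinuousLinearMap.smul_comp, RCLike.real_smul_eq_coe_smul (K := 𝕜) c (ψ.comp A), map_smul,
        smul_eq_mul, RCLike.re_ofReal_mul, smul_eq_mul])

/-- The real bilinear map `(Φ, ψ) ↦ Φ f • ψ` on `X** × Y*`. -/
noncomputable def bidualSMul (f : StrongDual 𝕜 X) :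
    WeakDual 𝕜 (StrongDual 𝕜 X) →ₗ[ℝ] StrongDual 𝕜 Y →ₗ[ℝ] StrongDual 𝕜 Y :=
  LinearMap.mk₂ ℝ (fun Φ ψ => Φ f • ψ)
    (fun Φ Ψ ψ => add_smul (Φ f) (Ψ f) ψ)
    (fun c Φ ψ => smul_assoc c (Φ f) ψ)
    (fun _ _ _ => smul_add _ _ _)
    (fun _ _ _ => smul_comm _ _ _)

lemma bidualPairing_apply (A : X →L[𝕜] Y) (Φ : WeakDual 𝕜 (StrongDual 𝕜 X))
    (ψ : StrongDual 𝕜 Y) : bidualPairing A Φ ψ = re (Φ (ψ.comp A)) := rfl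

lemma bidualSMul_apply (f : StrongDual 𝕜 X) (Φ : WeakDual 𝕜 (StrongDual 𝕜 X))
    (ψ : StrongDual 𝕜 Y) : bidualSMul f Φ ψ = Φ f • ψ := rfl

lemma continuous_bidualPairing_left (A : X →L[𝕜] Y) (ψ : StrongDual 𝕜 Y) :
    Continuous fun Φ => bidualPairing A Φ ψ :=
  continuous_re.comp (WeakDual.eval_continuous (ψ.comp A))

lemma continuous_bidualSMul_left (f : StrongDual 𝕜 X) (ψ : StrongDual 𝕜 Y) :
    Continuous fun Φ => bidualSMul f Φ ψ :=
  (WeakDual.eval_continuous f).smul continuous_const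

variable (𝕜 X) in
/-- The closed unit ball of `X**` with the weak-* topology. -/
def bidualBall : Set (WeakDual 𝕜 (StrongDual 𝕜 X)) :=
  WeakDual.toStrongDual ⁻¹' closedBall 0 1

lemma norm_apply_le_of_mem_bidualBall {Φ : WeakDual 𝕜 (StrongDual 𝕜 X)}
    (hΦ : Φ ∈ bidualBall 𝕜 X) (g : StrongDual 𝕜 X) : ‖Φ g‖ ≤ ‖g‖ := by
  have h1 : ‖WeakDual.toStrongDual Φ‖ ≤ 1 :=
    mem_closedBall_zero_iff (E := StrongDual 𝕜 (StrongDual 𝕜 X)) |>.1 hΦ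
  simpa using (WeakDual.toStrongDual Φ).le_of_opNorm_le h1 g

lemma isCompact_bidualBall : IsCompact (bidualBall 𝕜 X) := WeakDual.isCompact_closedBall 0 1

lemma convex_bidualBall : Convex ℝ (bidualBall 𝕜 X) := by
  intro Φ hΦ Ψ hΨ a b ha hb hab
  exact convex_closedBall (0 : StrongDual 𝕜 (StrongDual 𝕜 X)) 1 hΦ hΨ ha hb hab

lemma norm_comp_le_of_mem_closedBall (A : X →L[𝕜] Y) {ψ : StrongDual 𝕜 Y}
    (hψ : ψ ∈ closedBall (0 : StrongDual 𝕜 Y) 1) : ‖ψ.comp A‖ ≤ ‖A‖ :=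
  (ψ.opNorm_comp_le A).trans
    (mul_le_of_le_one_left (norm_nonneg _) (mem_closedBall_zero_iff.1 hψ))

lemma norm_apply_comp_le (A : X →L[𝕜] Y) {Φ : WeakDual 𝕜 (StrongDual 𝕜 X)}
    (hΦ : Φ ∈ bidualBall 𝕜 X) {ψ : StrongDual 𝕜 Y} (hψ : ψ ∈ closedBall (0 : StrongDual 𝕜 Y) 1) :
    ‖Φ (ψ.comp A)‖ ≤ ‖A‖ :=
  (norm_apply_le_of_mem_bidualBall hΦ _).trans (norm_comp_le_of_mem_closedBall A hψ)

lemma bidualPairing_le (A : X →L[𝕜] Y) {Φ : WeakDual 𝕜 (StrongDual 𝕜 X)}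
    (hΦ : Φ ∈ bidualBall 𝕜 X) {ψ : StrongDual 𝕜 Y} (hψ : ψ ∈ closedBall (0 : StrongDual 𝕜 Y) 1) :
    bidualPairing A Φ ψ ≤ ‖A‖ :=
  (re_le_norm _).trans (norm_apply_comp_le A hΦ hψ)

variable (𝕜 X) in
/-- The canonical embedding of `X` in its bidual with the weak-* topology. -/
noncomputable def toWeakBidual : X →ₗ[𝕜] WeakDual 𝕜 (StrongDual 𝕜 X) :=
  (NormedSpace.inclusionInDoubleDual 𝕜 X).toLinearMap

lemma toWeakBidual_apply (x : X) (g : StrongDual 𝕜 X) : toWeakBidual 𝕜 X x g = g x := rfl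

lemma toWeakBidual_mem_bidualBall {x : X} :
    toWeakBidual 𝕜 X x ∈ bidualBall 𝕜 X ↔ x ∈ closedBall (0 : X) 1 := by
  rw [mem_closedBall_zero_iff, ← (NormedSpace.inclusionInDoubleDualLi 𝕜).norm_map x]
  exact mem_closedBall_zero_iff (E := StrongDual 𝕜 (StrongDual 𝕜 X))

lemma toWeakBidual_injective : Function.Injective (toWeakBidual 𝕜 X) :=
  (NormedSpace.inclusionInDoubleDualLi 𝕜).injective

lemma realExtremePoint_of_toWeakBidual_mem_extremePoints {x : X}
    (h : toWeakBidual 𝕜 X x ∈ (bidualBall 𝕜 X).extremePoints ℝ) :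
    RealExtremePoint 𝕜 (closedBall (0 : X) 1) x := by
  refine ⟨toWeakBidual_mem_bidualBall.1 h.1, fun y hy z hz t ht ht1 hx => ?_⟩
  have hmem : toWeakBidual 𝕜 X x ∈ openSegment ℝ (toWeakBidual 𝕜 X y) (toWeakBidual 𝕜 X z) := by
    refine ⟨t, 1 - t, ht, sub_pos.2 ht1, by ring, DFunLike.ext _ _ fun g => ?_⟩
    change t • g y + (1 - t) • g z = g x
    rw [hx, map_add, map_smul, map_smul, RCLike.real_smul_eq_coe_mul, RCLike.real_smul_eq_coe_mul,
      smul_eq_mul, smul_eq_mul]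
  have := (mem_extremePoints.1 h).2 _ (toWeakBidual_mem_bidualBall.2 hy) _
    (toWeakBidual_mem_bidualBall.2 hz) hmem
  exact ⟨toWeakBidual_injective this.1, toWeakBidual_injective this.2⟩

lemma exists_eval_of_finiteDimensional [FiniteDimensional 𝕜 Y]
    (F : StrongDual 𝕜 (StrongDual 𝕜 Y)) : ∃ y : Y, ∀ ψ : StrongDual 𝕜 Y, F ψ = ψ y := by
  obtain ⟨y, hy⟩ := (Module.evalEquiv 𝕜 Y).surjective
    (F.toLinearMap ∘ₗ (LinearMap.toContinuousLinearMap (𝕜 := 𝕜) (E := Y) (F' := 𝕜)).toLinearMap)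
  refine ⟨y, fun ψ => ?_⟩
  have := LinearMap.congr_fun hy ψ.toLinearMap
  simp only [Module.evalEquiv_apply, Module.Dual.eval_apply] at this
  exact this.symm

variable [FiniteDimensional 𝕜 Y]

/-- If `A` is Birkhoff-James orthogonal to the operators vanishing on `ker f`, then `0` is a convex
combination of the functionals `Φ f • ψ`, where `(Φ, ψ)` ranges over the norming pairs of `A` in
the unit balls of `X**` and `Y*`. -/
theorem zero_mem_convexHull_bidualSMul (f : StrongDual 𝕜 X) (A : X →L[𝕜] Y)
    (h : ∀ y : Y, ‖A‖ ≤ ‖A - f.smulRight y‖) :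
    (0 : StrongDual 𝕜 Y) ∈ convexHull ℝ {k | ∃ Φ ∈ bidualBall 𝕜 X,
      ∃ ψ ∈ closedBall (0 : StrongDual 𝕜 Y) 1, bidualPairing A Φ ψ = ‖A‖ ∧
        bidualSMul f Φ ψ = k} := by
  have : FiniteDimensional ℝ (StrongDual 𝕜 Y) := FiniteDimensional.trans ℝ 𝕜 _
  have : ProperSpace (StrongDual 𝕜 Y) := FiniteDimensional.proper ℝ _
  let Q := bidualBall 𝕜 X ×ˢ closedBall (0 : StrongDual 𝕜 Y) 1
  have hQ : IsCompact Q := isCompact_bidualBall.prod (isCompact_closedBall 0 1)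
  have hb : Continuous fun p : WeakDual 𝕜 (StrongDual 𝕜 X) × StrongDual 𝕜 Y =>
      bidualPairing A p.1 p.2 :=
    LinearMap.continuous_uncurry_of_finiteDimensional (V := WeakDual 𝕜 (StrongDual 𝕜 X))
      (W := StrongDual 𝕜 Y) (F := ℝ) (bidualPairing A) (continuous_bidualPairing_left A)
  have hs : Continuous fun p : WeakDual 𝕜 (StrongDual 𝕜 X) × StrongDual 𝕜 Y =>
      bidualSMul f p.1 p.2 :=
    LinearMap.continuous_uncurry_of_finiteDimensional (V := WeakDual 𝕜 (StrongDual 𝕜 X))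
      (W := StrongDual 𝕜 Y) (F := StrongDual 𝕜 Y) (bidualSMul f) (continuous_bidualSMul_left f)
  set K := {k | ∃ Φ ∈ bidualBall 𝕜 X,
      ∃ ψ ∈ closedBall (0 : StrongDual 𝕜 Y) 1, bidualPairing A Φ ψ = ‖A‖ ∧
        bidualSMul f Φ ψ = k} with hKdef
  have hK : IsCompact K := by
    convert (hQ.inter_right (isClosed_eq hb (continuous_const (y := ‖A‖)))).image hs
    ext k
    simp only [hKdef, Q, mem_image, mem_inter_iff, mem_prod, Prod.exists, mem_ofPred_eq]
    exact ⟨fun ⟨Φ, hΦ, ψ, hψ, h1, h2⟩ => ⟨Φ, ψ, ⟨⟨hΦ, hψ⟩, h1⟩, h2⟩,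
      fun ⟨Φ, ψ, ⟨⟨hΦ, hψ⟩, h1⟩, h2⟩ => ⟨Φ, hΦ, ψ, hψ, h1, h2⟩⟩
  by_contra h0
  obtain ⟨F, u, hu, hF⟩ := RCLike.geometric_hahn_banach_point_closed (𝕜 := 𝕜)
    (convex_convexHull ℝ K) hK.convexHull_of_finiteDimensional.isClosed h0
  rw [map_zero, map_zero] at hu
  obtain ⟨y, hy⟩ := exists_eval_of_finiteDimensional F
  obtain ⟨⟨Φ, ψ⟩, ⟨hΦ, hψ⟩, hmin⟩ := hQ.exists_isMinOn
    (f := fun p => max (‖A‖ - bidualPairing A p.1 p.2) (re (F (bidualSMul f p.1 p.2))))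
    ⟨0, by simp [Q, bidualBall]⟩
    ((continuous_const.sub hb).max
      (continuous_re.comp (F.continuous.comp hs))).continuousOn
  have hsmall : ∀ t : ℝ, 0 < t → t ≤ 1 →
      max (‖A‖ - bidualPairing A Φ ψ) (re (F (bidualSMul f Φ ψ))) ≤ t * (1 + ‖f‖ * ‖y‖) := by
    intro t ht ht1
    obtain ⟨x, hx, hxA⟩ := ContinuousLinearMap.exists_lt_apply_of_lt_opNorm
      (A - f.smulRight ((t : 𝕜) • y)) (r := ‖A‖ - t ^ 2)
      ((sub_lt_self _ (by positivity)).trans_le (h _))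
    obtain ⟨χ, hχ, hχx⟩ := exists_dual_vector'' 𝕜 ((A - f.smulRight ((t : 𝕜) • y)) x)
    have hχ' : χ ∈ closedBall (0 : StrongDual 𝕜 Y) 1 := mem_closedBall_zero_iff.2 hχ
    have hxB : toWeakBidual 𝕜 X x ∈ bidualBall 𝕜 X :=
      toWeakBidual_mem_bidualBall.2 (mem_closedBall_zero_iff.2 hx.le)
    refine (hmin (show (toWeakBidual 𝕜 X x, χ) ∈ Q from ⟨hxB, hχ'⟩)).trans ?_
    have hle := bidualPairing_le A hxB hχ'
    have hre : re (F (bidualSMul f (toWeakBidual 𝕜 X x) χ)) = re (f x * χ y) := by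
      rw [hy]; rfl
    have hbd : |re (f x * χ y)| ≤ ‖f‖ * ‖y‖ := by
      refine (abs_re_le_norm _).trans ?_
      rw [norm_mul]
      gcongr
      · exact f.le_of_opNorm_le_of_le le_rfl hx.le |>.trans_eq (mul_one _)
      · simpa using χ.le_of_opNorm_le hχ y
    have hkey : bidualPairing A (toWeakBidual 𝕜 X x) χ - t * re (f x * χ y) > ‖A‖ - t ^ 2 := by
      refine hxA.trans_eq ?_
      rw [bidualPairing_apply, toWeakBidual_apply, ← re_ofReal_mul, ← map_sub,
        ← ofReal_re (K := 𝕜) ‖_‖, ← hχx]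
      congr 1
      simp only [sub_apply, ContinuousLinearMap.smulRight_apply, map_sub,
        map_smul, smul_eq_mul, ContinuousLinearMap.comp_apply]
      ring
    have hfy : 0 ≤ ‖f‖ * ‖y‖ := by positivity
    refine max_le ?_ ?_
    · dsimp only
      nlinarith [neg_le_of_abs_le hbd]
    · dsimp only
      rw [hre]
      nlinarith
  have hle : max (‖A‖ - bidualPairing A Φ ψ) (re (F (bidualSMul f Φ ψ))) ≤ 0 := by
    by_contra! hpos
    set m := max (‖A‖ - bidualPairing A Φ ψ) (re (F (bidualSMul f Φ ψ)))
    have hc : 0 < 1 + ‖f‖ * ‖y‖ := by positivity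
    have := hsmall (min 1 (m / (2 * (1 + ‖f‖ * ‖y‖)))) (by positivity) (min_le_left _ _)
    have h2 : min 1 (m / (2 * (1 + ‖f‖ * ‖y‖))) * (1 + ‖f‖ * ‖y‖) ≤ m / 2 :=
      (mul_le_mul_of_nonneg_right (min_le_right _ _) hc.le).trans_eq (by field_simp)
    linarith
  have hmem : bidualSMul f Φ ψ ∈ K := ⟨Φ, hΦ, ψ, hψ, (bidualPairing_le A hΦ hψ).antisymm
    (sub_nonpos.1 ((le_max_left _ _).trans hle)), rfl⟩
  linarith [hF _ (subset_convexHull ℝ K hmem), (le_max_right _ _).trans hle]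

/-- Each norming pair is replaced by norming pairs of extreme points, up to convex combinations. -/
theorem bidualSMul_mem_convexHull_extremePoints (f : StrongDual 𝕜 X) (A : X →L[𝕜] Y)
    {Φ : WeakDual 𝕜 (StrongDual 𝕜 X)} {ψ : StrongDual 𝕜 Y} (hΦ : Φ ∈ bidualBall 𝕜 X)
    (hψ : ψ ∈ closedBall (0 : StrongDual 𝕜 Y) 1) (hA : bidualPairing A Φ ψ = ‖A‖) :
    bidualSMul f Φ ψ ∈ convexHull ℝ {k | ∃ Φ ∈ (bidualBall 𝕜 X).extremePoints ℝ,
      ∃ ψ ∈ (closedBall (0 : StrongDual 𝕜 Y) 1).extremePoints ℝ, bidualPairing A Φ ψ = ‖A‖ ∧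
        bidualSMul f Φ ψ = k} := by
  have : FiniteDimensional ℝ (StrongDual 𝕜 Y) := FiniteDimensional.trans ℝ 𝕜 _
  have : ProperSpace (StrongDual 𝕜 Y) := FiniteDimensional.proper ℝ _
  have := WeakDual.locallyConvexSpace_real (𝕜 := 𝕜) (E := StrongDual 𝕜 X)
  have hb (Φ) := (bidualPairing (𝕜 := 𝕜) (X := X) A Φ).continuous_of_finiteDimensional
  have hs (Φ) := (bidualSMul (𝕜 := 𝕜) (Y := Y) f Φ).continuous_of_finiteDimensional
  have key := IsCompact.map₂_mem_convexHull_extremePoints (V := WeakDual 𝕜 (StrongDual 𝕜 X))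
    (W := StrongDual 𝕜 Y) (F := StrongDual 𝕜 Y) (P := bidualBall 𝕜 X)
    (R := closedBall (0 : StrongDual 𝕜 Y) 1)
  exact key isCompact_bidualBall convex_bidualBall (isCompact_closedBall 0 1)
    (convex_closedBall 0 1) (bidualPairing A) (continuous_bidualPairing_left A) hb (bidualSMul f) (continuous_bidualSMul_left f)
    hs (fun Φ hΦ ψ hψ => bidualPairing_le A hΦ hψ) hΦ hψ hA

/-- The pairs in `zero_mem_convexHull_bidualSMul` may be taken among pairs of extreme points. -/
theorem zero_mem_convexHull_bidualSMul_extremePoints (f : StrongDual 𝕜 X) (A : X →L[𝕜] Y)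
    (h : ∀ y : Y, ‖A‖ ≤ ‖A - f.smulRight y‖) :
    (0 : StrongDual 𝕜 Y) ∈ convexHull ℝ {k | ∃ Φ ∈ (bidualBall 𝕜 X).extremePoints ℝ,
      ∃ ψ ∈ (closedBall (0 : StrongDual 𝕜 Y) 1).extremePoints ℝ, bidualPairing A Φ ψ = ‖A‖ ∧
        bidualSMul f Φ ψ = k} := by
  refine convexHull_min ?_ (convex_convexHull ℝ _) (zero_mem_convexHull_bidualSMul f A h)
  rintro _ ⟨Φ, hΦ, ψ, hψ, hA, rfl⟩
  exact bidualSMul_mem_convexHull_extremePoints f A hΦ hψ hA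

end Pairings

lemma ZeroInRealConvexHull.of_zero_mem_convexHull {𝕜 E : Type*} [RCLike 𝕜] [AddCommGroup E]
    [Module 𝕜 E] [Module ℝ E] [IsScalarTower ℝ 𝕜 E] {F K : Set E}
    (h0 : (0 : E) ∈ convexHull ℝ K)
    (hK : ∀ k ∈ K, ∃ r : ℝ, 0 < r ∧ ∃ g ∈ F, k = (r : 𝕜) • g) : ZeroInRealConvexHull 𝕜 F := by
  obtain ⟨ι, _, z, w, hz, -, hw, hw1, hsum⟩ := eq_pos_convex_span_of_mem_convexHull h0
  choose r hr g hg hzg using fun i => hK (z i) (hz ⟨i, rfl⟩)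
  have : Nonempty ι := by
    by_contra hι
    rw [not_nonempty_iff] at hι
    simp at hw1
  have hS : 0 < ∑ i, w i * r i :=
    Finset.sum_pos (fun i _ => mul_pos (hw i) (hr i)) Finset.univ_nonempty
  let e := Fintype.equivFin ι
  refine ⟨Fintype.card ι, Fintype.card_pos, g ∘ e.symm,
    fun j => (w (e.symm j) * r (e.symm j)) / ∑ i, w i * r i, fun j => hg _,
    fun j => div_pos (mul_pos (hw _) (hr _)) hS, ?_, ?_⟩
  · rw [e.symm.sum_comp fun i => w i * r i / ∑ i, w i * r i, ← Finset.sum_div, div_self hS.ne']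
  · refine (e.symm.sum_comp fun i => ((w i * r i / ∑ i, w i * r i : ℝ) : 𝕜) • g i).trans ?_
    rw [← smul_zero ((((∑ i, w i * r i)⁻¹ : ℝ) : 𝕜)), ← hsum, Finset.smul_sum]
    refine Finset.sum_congr rfl fun i _ => ?_
    have hcast : w i • z i = (w i : 𝕜) • z i := by
      rw [RCLike.ofReal_alg, smul_assoc, one_smul]
    rw [hcast, hzg, smul_smul, smul_smul]
    congr 1
    push_cast
    ring

/-- **Theorem (Wójcik's theorem, generalized).**
Let `X` be a reflexive Banach space and `Y` an `n`-dimensional Banach space. Let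
`f ∈ S_{X*}`, `Z = ker f`, `A ∈ L(X,Y)`, `T₀ ∈ L_Z(X,Y)` and `A₀ = A - T₀`.
Suppose `A₀` does not attain its norm on `Z`, i.e. `M_{A₀} ∩ Z = ∅`. Let
`F_{A₀} = {y* ∈ Ext(B_{Y*}) : ∃ x ∈ M_{A₀} ∩ Ext(B_X), f(x) > 0, y*(A₀ x) = ‖A₀‖}`.
Then `A₀ ⊥_B L_Z(X,Y)` iff `0 ∈ conv(F_{A₀})`. -/
theorem birkhoff_orthogonality_LZ
    {𝕜 X Y : Type*} [RCLike 𝕜]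
    [NormedAddCommGroup X] [NormedSpace 𝕜 X] [CompleteSpace X]
    [NormedAddCommGroup Y] [NormedSpace 𝕜 Y] [CompleteSpace Y]
    {n : ℕ} (hdim : Module.finrank 𝕜 Y = n) [FiniteDimensional 𝕜 Y]
    (hrefl : Function.Surjective (NormedSpace.inclusionInDoubleDual 𝕜 X))
    (f : X →L[𝕜] 𝕜) (hf : ‖f‖ = 1)
    (A T₀ : X →L[𝕜] Y) (hT₀ : ∀ z : X, f z = 0 → T₀ z = 0)
    (A₀ : X →L[𝕜] Y) (hA₀ : A₀ = A - T₀)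
    (hnotattain : ∀ x : X, ‖x‖ = 1 → ‖A₀ x‖ = ‖A₀‖ → f x ≠ 0) :
    (∀ S : X →L[𝕜] Y, (∀ z : X, f z = 0 → S z = 0) →
        ∀ c : 𝕜, ‖A₀‖ ≤ ‖A₀ + c • S‖) ↔
      ZeroInRealConvexHull 𝕜
        {ystar : Y →L[𝕜] 𝕜 |
          RealExtremePoint 𝕜 (Metric.closedBall (0 : Y →L[𝕜] 𝕜) 1) ystar ∧
          ∃ x : X, (‖x‖ = 1 ∧ ‖A₀ x‖ = ‖A₀‖ ∧
              RealExtremePoint 𝕜 (Metric.closedBall (0 : X) 1) x) ∧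
            (∃ r : ℝ, 0 < r ∧ f x = (r : 𝕜)) ∧
            ystar (A₀ x) = (‖A₀‖ : 𝕜)} := by
  constructor
  · intro h
    have hf0 : f ≠ 0 := fun h0 => by simp [h0] at hf
    have : Nontrivial X := by
      obtain ⟨x, hx⟩ := DFunLike.ne_iff.1 hf0
      exact ⟨x, 0, fun hx0 => hx (by simp [hx0])⟩
    refine .of_zero_mem_convexHull (zero_mem_convexHull_bidualSMul_extremePoints f A₀ fun y => ?_) ?_
    · simpa [sub_eq_add_neg] using h (f.smulRight y) (fun z hz => by simp [hz]) (-1)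
    rintro _ ⟨Φ, hΦ, ψ, hψ, hA, rfl⟩
    obtain ⟨x, rfl⟩ : ∃ x, toWeakBidual 𝕜 X x = Φ := hrefl Φ
    have hx : RealExtremePoint 𝕜 (Metric.closedBall (0 : X) 1) x :=
      realExtremePoint_of_toWeakBidual_mem_extremePoints hΦ
    have hx1 := hx.norm_eq_one
    have hψx : ψ (A₀ x) = (‖A₀‖ : 𝕜) := by
      rw [← hA]
      exact (RCLike.re_eq_self_of_le ((norm_apply_comp_le A₀ hΦ.1 hψ.1).trans hA.ge)).symm
    have hnorm : ‖A₀ x‖ = ‖A₀‖ := by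
      refine le_antisymm (by simpa [hx1] using A₀.le_opNorm x) ?_
      have := ψ.le_of_opNorm_le (mem_closedBall_zero_iff.1 hψ.1) (A₀ x)
      simpa [hψx] using this
    have hfx : f x ≠ 0 := hnotattain x hx1 hnorm
    have hr : (‖f x‖ : 𝕜) ≠ 0 := by simpa using hfx
    have hu : ‖f x / (‖f x‖ : 𝕜)‖ = 1 := by simp [hfx]
    refine ⟨‖f x‖, norm_pos_iff.2 hfx, (f x / (‖f x‖ : 𝕜)) • ψ,
      ⟨(RealExtremePoint.of_mem_extremePoints hψ).smul_of_norm_eq_one hu,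
        (f x / (‖f x‖ : 𝕜))⁻¹ • x, ⟨?_, ?_, hx.smul_of_norm_eq_one (by rw [norm_inv, hu, inv_one])⟩,
        ⟨‖f x‖, norm_pos_iff.2 hfx, ?_⟩, ?_⟩, ?_⟩
    · rw [norm_smul, norm_inv, hu, inv_one, one_mul, hx1]
    · rw [map_smul, norm_smul, norm_inv, hu, inv_one, one_mul, hnorm]
    · rw [map_smul, smul_eq_mul]
      field_simp
    · rw [map_smul, smul_apply, map_smul, hψx, smul_smul,
        mul_inv_cancel₀ (div_ne_zero hfx hr), one_smul]
    · rw [bidualSMul_apply, toWeakBidual_apply, smul_smul, mul_div_cancel₀ _ hr]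
  · rintro ⟨m, hm, g, μ, hg, hμ, -, hsum⟩ S hS c
    obtain ⟨x₀, hx₀⟩ : ∃ x, f x = 1 := by
      have hf0 : f ≠ 0 := fun h0 => by simp [h0] at hf
      obtain ⟨x, hx⟩ := DFunLike.ne_iff.1 hf0
      exact ⟨(f x)⁻¹ • x, by simpa using inv_mul_cancel₀ hx⟩
    have hSf (x : X) : S x = f x • S x₀ := by
      rw [← map_smul, ← sub_eq_zero, ← map_sub]
      exact hS _ (by simp [hx₀])
    obtain ⟨i, hi⟩ : ∃ i, 0 ≤ RCLike.re (c * g i (S x₀)) := by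
      by_contra! hneg
      have h0 : ∑ i, μ i * RCLike.re (c * g i (S x₀)) = 0 := by
        have := congrArg (fun k : Y →L[𝕜] 𝕜 => RCLike.re (c * k (S x₀))) hsum
        simpa [-RCLike.mul_re, RCLike.smul_re, Finset.mul_sum, mul_left_comm c] using this
      have hlt : ∑ i, μ i * RCLike.re (c * g i (S x₀)) < 0 :=
        Finset.sum_neg (fun i _ => mul_neg_of_pos_of_neg (hμ i) (hneg i)) ⟨⟨0, hm⟩, by simp⟩
      exact hlt.ne h0
    obtain ⟨hgi, x, ⟨hx1, -, -⟩, ⟨r, hr, hfx⟩, hgx⟩ := hg i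
    have hle : ‖g i ((A₀ + c • S) x)‖ ≤ ‖A₀ + c • S‖ := by
      refine ((g i).le_of_opNorm_le (mem_closedBall_zero_iff.1 hgi.1) _).trans ?_
      simpa [hx1] using (A₀ + c • S).le_opNorm x
    refine le_trans ?_ ((RCLike.re_le_norm _).trans hle)
    have hval : g i ((A₀ + c • S) x) = (‖A₀‖ : 𝕜) + (r : 𝕜) * (c * g i (S x₀)) := by
      rw [add_apply, smul_apply, hSf, map_add, hgx, hfx,
        map_smul, map_smul, smul_eq_mul, smul_eq_mul]
      ring
    rw [hval, map_add, RCLike.ofReal_re, RCLike.re_ofReal_mul]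
    exact le_add_of_nonneg_right (mul_nonneg hr.le hi)
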